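/- arXiv:1511.07296 — 2 statements merged into one kernel-verified Lean document; each statement's English description precedes it below -/
import Mathlib

section
/- Let A be a 4-dimensional non-split non-Lie nilpotent Leibniz algebra over ℂ with dim A² = 2 and dim Leib(A) = 1 = dim A³. Then A is isomorphic to the Leibniz algebra with basis {x1,x2,x3,x4} whose nonzero products are given by one of the following: (A10) [x1,x1]=x4, [x1,x2]=x3, [x2,x1]=−x3, [x1,x3]=x4, [x3,x1]=−x4; (A11) [x1,x2]=x3, [x2,x1]=−x3, [x2,x2]=x4, [x1,x3]=x4, [x3,x1]=−x4; (A12) [x1,x1]=x4, [x1,x2]=x3, [x2,x1]=−x3+x4, [x1,x3]=x4, [x3,x1]=−x4; (A13) [x2,x2]=x4, [x1,x2]=x3, [x2,x1]=−x3+x4, [x1,x3]=x4, [x3,x1]=−x4. -/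
noncomputable section

/-- The span of all brackets `[a, b]` with `a ∈ A`, `b ∈ S`. -/
def bracketSpan {A : Type*} [AddCommGroup A] [Module ℂ A]
    (β : A →ₗ[ℂ] A →ₗ[ℂ] A) (S : Submodule ℂ A) : Submodule ℂ A :=
  Submodule.span ℂ {x | ∃ a : A, ∃ b ∈ S, x = β a b}

/-- `lpow β i` is `Aⁱ`: `A¹ = A` and `Aⁱ = [A, Aⁱ⁻¹]` for `i ≥ 2`
(with the convention `lpow β 0 = ⊤`). -/
def lpow {A : Type*} [AddCommGroup A] [Module ℂ A]
    (β : A →ₗ[ℂ] A →ₗ[ℂ] A) : ℕ → Submodule ℂ A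
  | 0 => ⊤
  | 1 => ⊤
  | n + 2 => bracketSpan β (lpow β (n + 1))

/-- `Leib(A)`, the span of all squares `[a, a]`. -/
def leibSpan {A : Type*} [AddCommGroup A] [Module ℂ A]
    (β : A →ₗ[ℂ] A →ₗ[ℂ] A) : Submodule ℂ A :=
  Submodule.span ℂ {x | ∃ a : A, x = β a a}

/-- The (left) Leibniz identity. -/
def IsLeibniz {A : Type*} [AddCommGroup A] [Module ℂ A]
    (β : A →ₗ[ℂ] A →ₗ[ℂ] A) : Prop :=
  ∀ a b c : A, β a (β b c) = β (β a b) c + β b (β a c)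

/-- Nilpotency: some term of the lower central series vanishes. -/
def LeibNilpotent {A : Type*} [AddCommGroup A] [Module ℂ A]
    (β : A →ₗ[ℂ] A →ₗ[ℂ] A) : Prop :=
  ∃ n : ℕ, lpow β n = ⊥

/-- The center `Z(A)` as a set. -/
def centerSet {A : Type*} [AddCommGroup A] [Module ℂ A]
    (β : A →ₗ[ℂ] A →ₗ[ℂ] A) : Set A :=
  {x | ∀ a : A, β x a = 0 ∧ β a x = 0}

/-- Two-sided ideal. -/
def LeibIsIdeal {A : Type*} [AddCommGroup A] [Module ℂ A]
    (β : A →ₗ[ℂ] A →ₗ[ℂ] A) (I : Submodule ℂ A) : Prop :=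
  ∀ x ∈ I, ∀ a : A, β x a ∈ I ∧ β a x ∈ I

/-- `A` is split if it is the (internal) direct sum of two nonzero two-sided ideals. -/
def LeibIsSplit {A : Type*} [AddCommGroup A] [Module ℂ A]
    (β : A →ₗ[ℂ] A →ₗ[ℂ] A) : Prop :=
  ∃ I J : Submodule ℂ A, LeibIsIdeal β I ∧ LeibIsIdeal β J ∧
    I ≠ ⊥ ∧ J ≠ ⊥ ∧ I ⊓ J = ⊥ ∧ I ⊔ J = ⊤

/-- Isomorphism of Leibniz algebras: a linear bijection preserving the bracket. -/
def LeibIso {A : Type*} [AddCommGroup A] [Module ℂ A]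
    {B : Type*} [AddCommGroup B] [Module ℂ B]
    (β : A →ₗ[ℂ] A →ₗ[ℂ] A) (γ : B →ₗ[ℂ] B →ₗ[ℂ] B) : Prop :=
  ∃ e : A ≃ₗ[ℂ] B, ∀ x y : A, e (β x y) = γ (e x) (e y)

/-- The bilinear product on `ℂ⁴` determined by structure constants
`f i j = [eᵢ, eⱼ]`. -/
def mkBil (f : Fin 4 → Fin 4 → Fin 4 → ℂ) :
    (Fin 4 → ℂ) →ₗ[ℂ] (Fin 4 → ℂ) →ₗ[ℂ] (Fin 4 → ℂ) :=
  LinearMap.mk₂ ℂ (fun x y => ∑ i, ∑ j, (x i * y j) • f i j)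
    (fun x x' y => by
      simp only [Pi.add_apply, add_mul, add_smul, Finset.sum_add_distrib])
    (fun c x y => by
      simp only [Pi.smul_apply, smul_eq_mul, Finset.smul_sum, mul_assoc, mul_smul])
    (fun x y y' => by
      simp only [Pi.add_apply, mul_add, add_smul, Finset.sum_add_distrib])
    (fun c x y => by
      simp only [Pi.smul_apply, smul_eq_mul, Finset.smul_sum, smul_smul, mul_left_comm])

/-- `E k` is the `k`-th standard basis vector of `ℂ⁴`. -/
def E (k : Fin 4) : Fin 4 → ℂ := Pi.single k 1

/-- Structure constants of the algebras `𝒜₁, …, 𝒜₂₅` (indices `0,1,2,3`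
correspond to `x₁, x₂, x₃, x₄`). -/
def sA1 : Fin 4 → Fin 4 → Fin 4 → ℂ :=
  ![![0, 0, E 3, 0], ![0, 0, 0, 0], ![0, E 3, 0, 0], 0]

def sA2 : Fin 4 → Fin 4 → Fin 4 → ℂ :=
  ![![0, 0, E 3, 0], ![0, E 3, E 3, 0], ![E 3, -E 3, 0, 0], 0]

def sA3 : Fin 4 → Fin 4 → Fin 4 → ℂ :=
  ![![0, E 3, 0, 0], ![-E 3, 0, 0, 0], ![0, 0, E 3, 0], 0]

def sA4 : Fin 4 → Fin 4 → Fin 4 → ℂ :=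
  ![![0, E 3, 0, 0], ![-E 3, E 3, 0, 0], ![0, 0, E 3, 0], 0]

def sA5 (c : ℂ) : Fin 4 → Fin 4 → Fin 4 → ℂ :=
  ![![0, E 3, 0, 0], ![c • E 3, 0, 0, 0], ![0, 0, E 3, 0], 0]

def sA6 : Fin 4 → Fin 4 → Fin 4 → ℂ :=
  ![![E 3, 0, 0, 0], ![0, E 3, 0, 0], ![0, 0, E 3, 0], 0]

def sA7 : Fin 4 → Fin 4 → Fin 4 → ℂ :=
  ![![E 1, E 2, E 3, 0], 0, 0, 0]

def sA8 : Fin 4 → Fin 4 → Fin 4 → ℂ :=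
  ![![E 3, E 2, 0, 0], ![-E 2, 0, 0, 0], 0, 0]

def sA9 : Fin 4 → Fin 4 → Fin 4 → ℂ :=
  ![![E 3, E 2, 0, 0], ![-E 2, E 3, 0, 0], 0, 0]

def sA10 : Fin 4 → Fin 4 → Fin 4 → ℂ :=
  ![![E 3, E 2, E 3, 0], ![-E 2, 0, 0, 0], ![-E 3, 0, 0, 0], 0]

def sA11 : Fin 4 → Fin 4 → Fin 4 → ℂ :=
  ![![0, E 2, E 3, 0], ![-E 2, E 3, 0, 0], ![-E 3, 0, 0, 0], 0]

def sA12 : Fin 4 → Fin 4 → Fin 4 → ℂ :=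
  ![![E 3, E 2, E 3, 0], ![-E 2 + E 3, 0, 0, 0], ![-E 3, 0, 0, 0], 0]

def sA13 : Fin 4 → Fin 4 → Fin 4 → ℂ :=
  ![![0, E 2, E 3, 0], ![-E 2 + E 3, E 3, 0, 0], ![-E 3, 0, 0, 0], 0]

def sA14 : Fin 4 → Fin 4 → Fin 4 → ℂ :=
  ![![E 2, E 3, 0, 0], 0, 0, 0]

def sA15 : Fin 4 → Fin 4 → Fin 4 → ℂ :=
  ![![E 2, 0, 0, 0], ![E 3, 0, 0, 0], 0, 0]

def sA16 : Fin 4 → Fin 4 → Fin 4 → ℂ :=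
  ![![0, E 3, 0, 0], ![E 2, -E 2, 0, 0], 0, 0]

def sA17 (α : ℂ) : Fin 4 → Fin 4 → Fin 4 → ℂ :=
  ![![E 2, E 3, 0, 0], ![α • E 3, 0, 0, 0], 0, 0]

def sA18 (α : ℂ) : Fin 4 → Fin 4 → Fin 4 → ℂ :=
  ![![E 2, α • E 2, 0, 0], ![E 3, -E 3, 0, 0], 0, 0]

def sA19 : Fin 4 → Fin 4 → Fin 4 → ℂ :=
  ![![E 2, E 2, 0, 0], ![E 2 + E 3, E 3, 0, 0], 0, 0]

def sA20 : Fin 4 → Fin 4 → Fin 4 → ℂ :=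
  ![![0, E 2, E 3, 0], 0, 0, 0]

def sA21 : Fin 4 → Fin 4 → Fin 4 → ℂ :=
  ![![0, E 2, E 3, 0], ![0, E 3, 0, 0], 0, 0]

def sA22 : Fin 4 → Fin 4 → Fin 4 → ℂ :=
  ![![0, E 2, E 3, 0], ![E 3, 0, 0, 0], 0, 0]

def sA23 : Fin 4 → Fin 4 → Fin 4 → ℂ :=
  ![![0, E 2, E 3, 0], ![E 3, E 3, 0, 0], 0, 0]

def sA24 : Fin 4 → Fin 4 → Fin 4 → ℂ :=
  ![![E 2, 0, E 3, 0], ![E 3, 0, 0, 0], 0, 0]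

def sA25 : Fin 4 → Fin 4 → Fin 4 → ℂ :=
  ![![E 2, 0, E 3, 0], ![0, E 3, 0, 0], 0, 0]

/-- The family `𝒜ᵢ`, `1 ≤ i ≤ 25`, with parameter `c` (used only for
`i = 5, 17, 18`). -/
def Alg : ℕ → ℂ → ((Fin 4 → ℂ) →ₗ[ℂ] (Fin 4 → ℂ) →ₗ[ℂ] (Fin 4 → ℂ))
  | 1, _ => mkBil sA1
  | 2, _ => mkBil sA2
  | 3, _ => mkBil sA3
  | 4, _ => mkBil sA4
  | 5, c => mkBil (sA5 c)
  | 6, _ => mkBil sA6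
  | 7, _ => mkBil sA7
  | 8, _ => mkBil sA8
  | 9, _ => mkBil sA9
  | 10, _ => mkBil sA10
  | 11, _ => mkBil sA11
  | 12, _ => mkBil sA12
  | 13, _ => mkBil sA13
  | 14, _ => mkBil sA14
  | 15, _ => mkBil sA15
  | 16, _ => mkBil sA16
  | 17, c => mkBil (sA17 c)
  | 18, c => mkBil (sA18 c)
  | 19, _ => mkBil sA19
  | 20, _ => mkBil sA20
  | 21, _ => mkBil sA21
  | 22, _ => mkBil sA22
  | 23, _ => mkBil sA23
  | 24, _ => mkBil sA24
  | 25, _ => mkBil sA25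
  | _, _ => 0

/-- Admissibility of the index `i` and the parameter `c` for the family `𝒜ᵢ`. -/
def Adm (i : ℕ) (c : ℂ) : Prop :=
  1 ≤ i ∧ i ≤ 25 ∧ (i = 5 → (c ≠ 1 ∧ c ≠ -1)) ∧
    (i = 17 → (c ≠ -1 ∧ c ≠ 0)) ∧ (i = 18 → c ≠ -1)

section AdaptedBasis

variable {A : Type*} [AddCommGroup A] [Module ℂ A]

/-- The products of `x₁, x₂, x₃, x₄` are those of the Heisenberg-type normal form with parameters
`a, b, c`: `[x₁,x₁] = a x₄`, `[x₁,x₂] = x₃`, `[x₂,x₁] = -x₃ + b x₄`, `[x₂,x₂] = c x₄`,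
`[x₁,x₃] = x₄ = -[x₃,x₁]`, all other products being zero. -/
structure IsAdapted (β : A →ₗ[ℂ] A →ₗ[ℂ] A) (x₁ x₂ x₃ x₄ : A) (a b c : ℂ) : Prop where
  ne_zero : x₄ ≠ 0
  mul₁₁ : β x₁ x₁ = a • x₄
  mul₁₂ : β x₁ x₂ = x₃
  mul₂₁ : β x₂ x₁ = -x₃ + b • x₄
  mul₂₂ : β x₂ x₂ = c • x₄
  mul₁₃ : β x₁ x₃ = x₄
  mul₂₃ : β x₂ x₃ = 0
  mul₃₁ : β x₃ x₁ = -x₄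
  mul₃₂ : β x₃ x₂ = 0
  mul₃₃ : β x₃ x₃ = 0
  left_central : ∀ y, β x₄ y = 0
  right_central : ∀ y, β y x₄ = 0

namespace IsAdapted

variable {β : A →ₗ[ℂ] A →ₗ[ℂ] A} {x₁ x₂ x₃ x₄ : A} {a b c : ℂ}

theorem linearIndependent (h : IsAdapted β x₁ x₂ x₃ x₄ a b c) :
    LinearIndependent ℂ ![x₁, x₂, x₃, x₄] := by
  rw [Fintype.linearIndependent_iff]
  intro g hg
  simp only [Fin.sum_univ_four, Matrix.cons_val] at hg
  have h0 : g 0 = 0 := by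
    have := congrArg (fun t => β t x₃) hg
    simpa [h.mul₁₃, h.mul₂₃, h.mul₃₃, h.left_central, h.ne_zero] using this
  have h1 : g 1 = 0 := by
    have := congrArg (fun t => β x₁ (β x₁ t)) hg
    simpa [h0, h.mul₁₂, h.mul₁₃, h.right_central, h.ne_zero] using this
  have h2 : g 2 = 0 := by
    have := congrArg (fun t => β x₁ t) hg
    simpa [h0, h1, h.mul₁₃, h.right_central, h.ne_zero] using this
  have h3 : g 3 = 0 := by
    simpa [h0, h1, h2, h.ne_zero] using hg
  intro i
  fin_cases i <;> assumption

/-- The basis underlying an adapted system of vectors in dimension four. -/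
def basis (h : IsAdapted β x₁ x₂ x₃ x₄ a b c) (hdim : Module.finrank ℂ A = 4) :
    Module.Basis (Fin 4) ℂ A :=
  basisOfLinearIndependentOfCardEqFinrank h.linearIndependent (by simp [hdim])

theorem coe_basis (h : IsAdapted β x₁ x₂ x₃ x₄ a b c) (hdim : Module.finrank ℂ A = 4) :
    ⇑(h.basis hdim) = ![x₁, x₂, x₃, x₄] :=
  coe_basisOfLinearIndependentOfCardEqFinrank _ _

/-- If the `x₁`-component of the change of basis is `r x₁ + s x₂` and the `x₂`-component is `t x₂`,
the parameters change as binary quadratic forms do, up to scaling. -/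
theorem change (h : IsAdapted β x₁ x₂ x₃ x₄ a b c) {r s t a' b' c' : ℂ}
    (hr : r ≠ 0) (ht : t ≠ 0)
    (ha : a' * (r ^ 2 * t) = r ^ 2 * a + r * s * b + s ^ 2 * c)
    (hb : b' * r ^ 2 = r * b + 2 * s * c) (hc : c' * r ^ 2 = t * c) :
    IsAdapted β (r • x₁ + s • x₂) (t • x₂) ((r * t) • x₃ + (s * t * c) • x₄)
      ((r ^ 2 * t) • x₄) a' b' c' where
  ne_zero := by simp [h.ne_zero, hr, ht]
  mul₁₁ := by
    simp only [map_add, map_smul, LinearMap.add_apply, LinearMap.smul_apply, smul_smul, ha,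
      h.mul₁₁, h.mul₁₂, h.mul₂₁, h.mul₂₂]
    module
  mul₁₂ := by
    simp only [map_add, map_smul, LinearMap.add_apply, LinearMap.smul_apply, h.mul₁₂, h.mul₂₂]
    module
  mul₂₁ := by
    have hb' : b' * (r ^ 2 * t) = (r * b + 2 * s * c) * t := by rw [← hb]; ring
    simp only [map_add, map_smul, LinearMap.smul_apply, smul_smul, hb',
      h.mul₂₁, h.mul₂₂]
    module
  mul₂₂ := by
    have hc' : c' * (r ^ 2 * t) = t * c * t := by rw [← hc]; ring
    simp only [map_smul, LinearMap.smul_apply, smul_smul, hc', h.mul₂₂]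
    module
  mul₁₃ := by
    simp only [map_add, map_smul, LinearMap.add_apply, LinearMap.smul_apply, h.mul₁₃, h.mul₂₃,
      h.right_central]
    module
  mul₂₃ := by simp [h.mul₂₃, h.right_central]
  mul₃₁ := by
    simp only [map_add, map_smul, LinearMap.add_apply, LinearMap.smul_apply, h.mul₃₁, h.mul₃₂,
      h.left_central]
    module
  mul₃₂ := by simp [h.mul₃₂, h.left_central]
  mul₃₃ := by simp [h.mul₃₃, h.left_central, h.right_central]
  left_central y := by simp [h.left_central]
  right_central y := by simp [h.right_central]

theorem eq_zero_of_squares (h : IsAdapted β x₁ x₂ x₃ x₄ 0 0 0)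
    (hdim : Module.finrank ℂ A = 4) (x : A) : β x x = 0 := by
  have hx := (h.basis hdim).sum_repr x
  generalize (h.basis hdim).repr x = g at hx
  simp only [h.coe_basis, Fin.sum_univ_four, Matrix.cons_val] at hx
  rw [← hx]
  simp only [map_add, map_smul, LinearMap.add_apply, LinearMap.smul_apply, h.mul₁₁, h.mul₁₂,
    h.mul₁₃, h.mul₂₁, h.mul₂₂, h.mul₂₃, h.mul₃₁, h.mul₃₂, h.mul₃₃, h.left_central,
    h.right_central]
  module

end IsAdapted

theorem mkBil_E (f : Fin 4 → Fin 4 → Fin 4 → ℂ) (i j : Fin 4) :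
    mkBil f (E i) (E j) = f i j := by
  simp [mkBil, E, Pi.single_apply, ite_smul]

/-- A basis realizing the structure constants `f` identifies the algebra with `mkBil f`. -/
theorem leibIso_mkBil {β : A →ₗ[ℂ] A →ₗ[ℂ] A} (v : Module.Basis (Fin 4) ℂ A)
    (f : Fin 4 → Fin 4 → Fin 4 → ℂ) (h : ∀ i j, v.equivFun (β (v i) (v j)) = f i j) :
    LeibIso β (mkBil f) := by
  refine ⟨v.equivFun, fun x y => ?_⟩
  have hE (i : Fin 4) : v.equivFun (v i) = E i := by
    ext j
    simp [E, Pi.single_apply, eq_comm]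
  have key : β.compr₂ v.equivFun.toLinearMap =
      (mkBil f).compl₁₂ v.equivFun.toLinearMap v.equivFun.toLinearMap := by
    refine v.ext fun i => v.ext fun j => ?_
    simp only [LinearMap.compr₂_apply, LinearMap.compl₁₂_apply, LinearEquiv.coe_coe, h, hE,
      mkBil_E]
  exact LinearMap.congr_fun₂ key x y

/-- The structure constants of the normal form with parameters `a, b, c`. -/
def adaptedConst (a b c : ℂ) : Fin 4 → Fin 4 → Fin 4 → ℂ :=
  ![![a • E 3, E 2, E 3, 0], ![-E 2 + b • E 3, c • E 3, 0, 0], ![-E 3, 0, 0, 0], 0]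

namespace IsAdapted

variable {β : A →ₗ[ℂ] A →ₗ[ℂ] A} {x₁ x₂ x₃ x₄ : A} {a b c : ℂ}

theorem leibIso (h : IsAdapted β x₁ x₂ x₃ x₄ a b c) (hdim : Module.finrank ℂ A = 4) :
    LeibIso β (mkBil (adaptedConst a b c)) := by
  have hE (i : Fin 4) : (h.basis hdim).equivFun (h.basis hdim i) = E i := by
    ext j
    simp [E, Pi.single_apply, eq_comm]
  have e₃ : (h.basis hdim).equivFun x₃ = E 2 := by rw [← hE 2, h.coe_basis]; rfl
  have e₄ : (h.basis hdim).equivFun x₄ = E 3 := by rw [← hE 3, h.coe_basis]; rfl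
  refine leibIso_mkBil (h.basis hdim) _ fun i j => ?_
  rw [h.coe_basis]
  fin_cases i <;> fin_cases j <;>
    simp only [adaptedConst, Fin.zero_eta, Fin.mk_one, Fin.reduceFinMk, Matrix.cons_val,
      Pi.zero_apply, h.mul₁₁, h.mul₁₂, h.mul₁₃, h.mul₂₁, h.mul₂₂, h.mul₂₃, h.mul₃₁, h.mul₃₂,
      h.mul₃₃, h.left_central, h.right_central, map_add, map_neg, map_smul, map_zero, e₃, e₄]

/-- Normalization of the parameters of an adapted system. -/
theorem classification (h : IsAdapted β x₁ x₂ x₃ x₄ a b c) (hdim : Module.finrank ℂ A = 4)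
    (hβ : ∃ x, β x x ≠ 0) :
    LeibIso β (mkBil sA10) ∨ LeibIso β (mkBil sA11) ∨
      LeibIso β (mkBil sA12) ∨ LeibIso β (mkBil sA13) := by
  have s10 : adaptedConst 1 0 0 = sA10 := by simp [adaptedConst, sA10]
  have s11 : adaptedConst 0 0 1 = sA11 := by simp [adaptedConst, sA11]
  have s12 : adaptedConst 1 1 0 = sA12 := by simp [adaptedConst, sA12]
  have s13 : adaptedConst 0 1 1 = sA13 := by simp [adaptedConst, sA13]
  rw [← s10, ← s11, ← s12, ← s13]
  by_cases hc : c = 0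
  · subst hc
    by_cases hb : b = 0
    · subst hb
      have ha : a ≠ 0 := by
        rintro rfl
        obtain ⟨x, hx⟩ := hβ
        exact hx (h.eq_zero_of_squares hdim x)
      left
      exact (h.change (r := 1) (s := 0) (t := a) one_ne_zero ha
        (by ring) (by ring) (by ring)).leibIso hdim
    · right; right; left
      refine (h.change (r := b) (s := 1 - a) (t := 1) hb one_ne_zero
        (by ring) (by ring) (by ring)).leibIso hdim
  · obtain ⟨d, hd⟩ := IsAlgClosed.exists_pow_nat_eq (b ^ 2 - 4 * a * c) zero_lt_two
    by_cases hd0 : d = 0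
    · subst hd0
      right; left
      refine (h.change (r := 2 * c) (s := -b) (t := 4 * c) (by simpa using hc) (by simpa using hc)
        ?_ ?_ ?_).leibIso hdim
      · linear_combination -c * hd
      · ring
      · ring
    · right; right; right
      refine (h.change (r := d) (s := d * (d - b) / (2 * c)) (t := d ^ 2 / c) hd0
        (div_ne_zero (pow_ne_zero _ hd0) hc) ?_ ?_ ?_).leibIso hdim
      · field_simp
        linear_combination -hd
      · field_simp; ring
      · field_simp

end IsAdapted

end AdaptedBasis

section LowerCentralSeries

variable {A : Type*} [AddCommGroup A] [Module ℂ A] {β : A →ₗ[ℂ] A →ₗ[ℂ] A}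

theorem mul_mem_bracketSpan {S : Submodule ℂ A} (a : A) {b : A} (hb : b ∈ S) :
    β a b ∈ bracketSpan β S :=
  Submodule.subset_span ⟨a, b, hb, rfl⟩

theorem mul_mem_lpow_succ {n : ℕ} (a : A) {b : A} (hb : b ∈ lpow β (n + 1)) :
    β a b ∈ lpow β (n + 2) :=
  mul_mem_bracketSpan a hb

theorem mul_self_mem_leibSpan (a : A) : β a a ∈ leibSpan β :=
  Submodule.subset_span ⟨a, rfl⟩

theorem mul_add_mul_mem_leibSpan (a b : A) : β a b + β b a ∈ leibSpan β := by
  have h : β a b + β b a = β (a + b) (a + b) - β a a - β b b := by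
    simp only [map_add, LinearMap.add_apply]
    abel
  rw [h]
  exact sub_mem (sub_mem (mul_self_mem_leibSpan _) (mul_self_mem_leibSpan _))
    (mul_self_mem_leibSpan _)

theorem lpow_antitone (β : A →ₗ[ℂ] A →ₗ[ℂ] A) (n : ℕ) :
    lpow β (n + 2) ≤ lpow β (n + 1) := by
  induction n with
  | zero => exact le_top
  | succ n ih =>
    refine Submodule.span_le.2 ?_
    rintro _ ⟨a, b, hb, rfl⟩
    exact mul_mem_lpow_succ a (ih hb)

theorem lpow_eq_of_stable {n : ℕ} (h : lpow β (n + 2) = lpow β (n + 1)) (k : ℕ) :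
    lpow β (n + 1 + k) = lpow β (n + 1) := by
  induction k with
  | zero => rfl
  | succ k ih =>
    calc lpow β (n + 1 + (k + 1)) = bracketSpan β (lpow β (n + 1 + k)) := by
          rw [show n + 1 + (k + 1) = n + k + 2 by ring, show n + 1 + k = n + k + 1 by ring, lpow]
      _ = lpow β (n + 1) := by rw [ih]; exact h

theorem lpow_four_eq_bot (hnilp : LeibNilpotent β)
    (hA3 : Module.finrank ℂ (lpow β 3) = 1) : lpow β 4 = ⊥ := by
  have hfd : FiniteDimensional ℂ (lpow β 3) := Module.finite_of_finrank_eq_succ hA3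
  by_contra h4
  have hle : lpow β 4 ≤ lpow β 3 := lpow_antitone β 2
  have hfd4 : FiniteDimensional ℂ (lpow β 4) := Submodule.finiteDimensional_of_le hle
  have heq : lpow β 4 = lpow β 3 := by
    refine Submodule.eq_of_le_of_finrank_le hle ?_
    rw [hA3]
    exact Submodule.one_le_finrank_iff.2 h4
  have hne : lpow β 3 ≠ ⊥ := heq ▸ h4
  obtain ⟨n, hn⟩ := hnilp
  have hstab := lpow_eq_of_stable heq
  have hmono : ∀ m, lpow β (m + 1) = ⊥ → lpow β (m + 2) = ⊥ := fun m hm =>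
    le_bot_iff.1 (hm ▸ lpow_antitone β m)
  have hall : ∀ k, lpow β (n + 1 + k) = ⊥ := by
    intro k
    induction k with
    | zero =>
      rcases n with _ | n
      · have : Subsingleton (Submodule ℂ A) :=
          subsingleton_of_bot_eq_top (α := Submodule ℂ A) hn.symm
        exact Subsingleton.elim _ _
      · exact hmono n hn
    | succ k ih =>
      rw [show n + 1 + (k + 1) = n + k + 2 by ring]
      exact hmono (n + k) (by rw [show n + k + 1 = n + 1 + k by ring]; exact ih)
  apply hne
  rw [← hstab n, show 2 + 1 + n = n + 1 + 2 by ring]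
  exact hall 2

theorem mul_mem_lpow_three (hleib : IsLeibniz β) {u : A} (hu : u ∈ lpow β 2) (y : A) :
    β u y ∈ lpow β 3 := by
  have hu' : u ∈ bracketSpan β (lpow β 1) := hu
  induction hu' using Submodule.span_induction with
  | mem x hx =>
    obtain ⟨a, b, -, rfl⟩ := hx
    rw [← sub_eq_iff_eq_add.2 (hleib a b y)]
    have h (z w : A) : β z w ∈ lpow β 2 := mul_mem_lpow_succ (n := 0) z trivial
    exact sub_mem (mul_mem_lpow_succ a (h _ _)) (mul_mem_lpow_succ b (h _ _))
  | zero => simp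
  | add x z hx hz ihx ihz =>
    simpa using add_mem (ihx hx) (ihz hz)
  | smul r x hx ih =>
    simpa using Submodule.smul_mem _ r (ih hx)

theorem lpow_two_mul_lpow_two (hleib : IsLeibniz β) (h4 : lpow β 4 = ⊥) {u v : A}
    (hu : u ∈ lpow β 2) (hv : v ∈ lpow β 2) : β u v = 0 := by
  have hu' : u ∈ bracketSpan β (lpow β 1) := hu
  induction hu' using Submodule.span_induction with
  | mem x hx =>
    obtain ⟨a, b, -, rfl⟩ := hx
    have h (z w : A) : β z (β w v) = 0 := (Submodule.mem_bot ℂ).1 <| h4 ▸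
      mul_mem_lpow_succ (n := 2) z (mul_mem_lpow_succ (n := 1) w hv)
    simpa [h] using (hleib a b v).symm
  | zero => simp
  | add x z hx hz ihx ihz => simp [ihx hx, ihz hz]
  | smul r x hx ih => simp [ih hx]

theorem lpow_three_mul (hleib : IsLeibniz β) (h4 : lpow β 4 = ⊥) {u : A}
    (hu : u ∈ lpow β 3) (y : A) : β u y = 0 := by
  have hu' : u ∈ bracketSpan β (lpow β 2) := hu
  induction hu' using Submodule.span_induction with
  | mem x hx =>
    obtain ⟨a, b, hb, rfl⟩ := hx
    have h₁ : β a (β b y) = 0 := (Submodule.mem_bot ℂ).1 <| h4 ▸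
      mul_mem_lpow_succ (n := 2) a (mul_mem_lpow_three hleib hb y)
    have h₂ : β b (β a y) = 0 :=
      lpow_two_mul_lpow_two hleib h4 hb (mul_mem_lpow_succ (n := 0) a trivial)
    simpa [h₁, h₂] using (hleib a b y).symm
  | zero => simp
  | add x z hx hz ihx ihz => simp [ihx hx, ihz hz]
  | smul r x hx ih => simp [ih hx]

theorem mul_lpow_three (h4 : lpow β 4 = ⊥) (y : A) {u : A} (hu : u ∈ lpow β 3) :
    β y u = 0 :=
  (Submodule.mem_bot ℂ).1 <| h4 ▸ mul_mem_lpow_succ (n := 2) y hu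

/-- If `dim A² = 2` and `dim A³ = 1`, then any element of `A² \ A³` spans `A²` modulo `A³`. -/
theorem exists_smul_add_of_mem_lpow_two (hA2 : Module.finrank ℂ (lpow β 2) = 2)
    (hA3 : Module.finrank ℂ (lpow β 3) = 1) {z : A} (hz : z ∈ lpow β 2) (hz3 : z ∉ lpow β 3)
    {u : A} (hu : u ∈ lpow β 2) : ∃ r : ℂ, ∃ w ∈ lpow β 3, u = r • z + w := by
  have hfd : FiniteDimensional ℂ (lpow β 2) := Module.finite_of_finrank_eq_succ hA2
  have hle : Submodule.span ℂ {z} ⊔ lpow β 3 ≤ lpow β 2 :=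
    sup_le ((Submodule.span_singleton_le_iff_mem _ _).2 hz) (lpow_antitone β 1)
  have hfd' := Submodule.finiteDimensional_of_le hle
  have hlt : lpow β 3 < Submodule.span ℂ {z} ⊔ lpow β 3 := by
    refine lt_of_le_of_ne le_sup_right fun h => hz3 ?_
    rw [h]
    exact Submodule.mem_sup_left (Submodule.mem_span_singleton_self z)
  have heq := Submodule.eq_of_le_of_finrank_le hle (by
    have := Submodule.finrank_lt_finrank_of_lt hlt
    omega)
  rw [← heq, Submodule.mem_sup] at hu
  obtain ⟨y, hy, w, hw, rfl⟩ := hu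
  obtain ⟨r, rfl⟩ := Submodule.mem_span_singleton.1 hy
  exact ⟨r, w, hw, rfl⟩

theorem leibSpan_eq_lpow_three (hleib : IsLeibniz β) (h4 : lpow β 4 = ⊥)
    (hA2 : Module.finrank ℂ (lpow β 2) = 2) (hA3 : Module.finrank ℂ (lpow β 3) = 1)
    (hLeib : Module.finrank ℂ (leibSpan β) = 1) : leibSpan β = lpow β 3 := by
  have hfd : FiniteDimensional ℂ (lpow β 3) := Module.finite_of_finrank_eq_succ hA3
  refine Submodule.eq_of_le_of_finrank_eq (Submodule.span_le.2 ?_) (hLeib.trans hA3.symm)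
  rintro _ ⟨a, rfl⟩
  by_contra ha
  change β a a ∉ lpow β 3 at ha
  have ha2 : β a a ∈ lpow β 2 := mul_mem_lpow_succ (n := 0) a trivial
  have hne : (⟨β a a, mul_self_mem_leibSpan a⟩ : leibSpan β) ≠ 0 := fun h =>
    ha ((show β a a = 0 from Subtype.ext_iff.1 h).symm ▸ zero_mem _)
  have hmul (y : A) : β y (β a a) = 0 := by
    have hmem : β y (β a a) ∈ leibSpan β := by
      rw [hleib, add_comm]
      exact mul_add_mul_mem_leibSpan a (β y a)
    obtain ⟨r, hr⟩ := (finrank_eq_one_iff_of_nonzero' _ hne).1 hLeib ⟨_, hmem⟩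
    have hr' : r • β a a = β y (β a a) := Subtype.ext_iff.1 hr
    have hr0 : r = 0 := by
      by_contra hr0
      refine ha (((lpow β 3).smul_mem_iff hr0).1 ?_)
      rw [hr']
      exact mul_mem_lpow_succ (n := 1) y ha2
    rw [← hr', hr0, zero_smul]
  have hbot : lpow β 3 = ⊥ := by
    refine le_bot_iff.1 (Submodule.span_le.2 ?_)
    rintro _ ⟨y, u, hu, rfl⟩
    obtain ⟨r, w, hw, rfl⟩ := exists_smul_add_of_mem_lpow_two hA2 hA3 ha2 ha hu
    simp [hmul, mul_lpow_three h4 y hw]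
  rw [hbot, finrank_bot] at hA3
  exact zero_ne_one hA3

/-- There are `x₁, x₂` spanning `A` modulo `A²` such that `[x₂, A²] = 0` and
`[x₁, z] ≠ 0` for all `z ∈ A² \ A³`. -/
theorem exists_generators (hleib : IsLeibniz β) (h4 : lpow β 4 = ⊥)
    (hdim : Module.finrank ℂ A = 4)
    (hA2 : Module.finrank ℂ (lpow β 2) = 2) (hA3 : Module.finrank ℂ (lpow β 3) = 1) :
    ∃ x₁ x₂ : A, (∀ z ∈ lpow β 2, z ∉ lpow β 3 → β x₁ z ≠ 0) ∧ (∀ z ∈ lpow β 2, β x₂ z = 0) ∧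
      ∀ y, ∃ p q : ℂ, ∃ u ∈ lpow β 2, y = p • x₁ + q • x₂ + u := by
  have hfd : FiniteDimensional ℂ A := Module.finite_of_finrank_eq_succ hdim
  obtain ⟨z, hz, hz3⟩ : ∃ z ∈ lpow β 2, z ∉ lpow β 3 := by
    by_contra! h
    have := Submodule.finrank_mono (show lpow β 2 ≤ lpow β 3 from h)
    omega
  have hspan {u : A} (hu : u ∈ lpow β 2) := exists_smul_add_of_mem_lpow_two hA2 hA3 hz hz3 hu
  obtain ⟨x₁, hx₁⟩ : ∃ x₁, β x₁ z ≠ 0 := by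
    by_contra! h
    have hbot : lpow β 3 = ⊥ := by
      refine le_bot_iff.1 (Submodule.span_le.2 ?_)
      rintro _ ⟨y, u, hu, rfl⟩
      obtain ⟨r, w, hw, rfl⟩ := hspan hu
      simp [h, mul_lpow_three h4 y hw]
    rw [hbot, finrank_bot] at hA3
    exact zero_ne_one hA3
  set L : A →ₗ[ℂ] A := β.flip z with hL
  have hrange : LinearMap.range L ≤ lpow β 3 := by
    rintro _ ⟨y, rfl⟩
    exact mul_mem_lpow_succ (n := 1) y hz
  have hker : lpow β 2 ≤ LinearMap.ker L := fun u hu => lpow_two_mul_lpow_two hleib h4 hu hz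
  have hrank := L.finrank_range_add_finrank_ker
  have hrange' := Submodule.finrank_mono hrange
  obtain ⟨x₂, hx₂, hx₂'⟩ : ∃ x₂ ∈ LinearMap.ker L, x₂ ∉ lpow β 2 := by
    by_contra! h
    have := Submodule.finrank_mono (show LinearMap.ker L ≤ lpow β 2 from h)
    omega
  have hlt₁ : lpow β 2 < Submodule.span ℂ {x₂} ⊔ lpow β 2 := by
    refine lt_of_le_of_ne le_sup_right fun h => hx₂' ?_
    rw [h]
    exact Submodule.mem_sup_left (Submodule.mem_span_singleton_self _)
  have hlt₂ : Submodule.span ℂ {x₂} ⊔ lpow β 2 <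
      Submodule.span ℂ {x₁} ⊔ (Submodule.span ℂ {x₂} ⊔ lpow β 2) := by
    refine lt_of_le_of_ne le_sup_right fun h => hx₁ ?_
    have hmem : x₁ ∈ Submodule.span ℂ {x₂} ⊔ lpow β 2 := by
      rw [h]
      exact Submodule.mem_sup_left (Submodule.mem_span_singleton_self _)
    exact sup_le ((Submodule.span_singleton_le_iff_mem _ _).2 hx₂) hker hmem
  have htop : Submodule.span ℂ {x₁} ⊔ (Submodule.span ℂ {x₂} ⊔ lpow β 2) = ⊤ := by
    have h₁ := Submodule.finrank_lt_finrank_of_lt hlt₁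
    have h₂ := Submodule.finrank_lt_finrank_of_lt hlt₂
    refine Submodule.eq_top_of_finrank_eq (le_antisymm (Submodule.finrank_le _) ?_)
    omega
  refine ⟨x₁, x₂, fun u hu hu3 h => ?_, fun u hu => ?_, fun y => ?_⟩
  · obtain ⟨r, w, hw, rfl⟩ := hspan hu
    have hr : r = 0 := by simpa [mul_lpow_three h4 _ hw, hx₁] using h
    exact hu3 (by simpa [hr] using hw)
  · obtain ⟨r, w, hw, rfl⟩ := hspan hu
    have hx₂z : β x₂ z = 0 := hx₂
    simp [mul_lpow_three h4 _ hw, hx₂z]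
  · have hy : y ∈ Submodule.span ℂ {x₁} ⊔ (Submodule.span ℂ {x₂} ⊔ lpow β 2) := htop ▸ trivial
    obtain ⟨_, h₁, _, h₂, rfl⟩ := Submodule.mem_sup.1 hy
    obtain ⟨_, h₃, u, hu, rfl⟩ := Submodule.mem_sup.1 h₂
    obtain ⟨p, rfl⟩ := Submodule.mem_span_singleton.1 h₁
    obtain ⟨q, rfl⟩ := Submodule.mem_span_singleton.1 h₃
    exact ⟨p, q, u, hu, (add_assoc _ _ _).symm⟩

theorem exists_isAdapted (hleib : IsLeibniz β) (h4 : lpow β 4 = ⊥)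
    (hdim : Module.finrank ℂ A = 4)
    (hA2 : Module.finrank ℂ (lpow β 2) = 2) (hA3 : Module.finrank ℂ (lpow β 3) = 1)
    (hLeib : Module.finrank ℂ (leibSpan β) = 1) :
    ∃ (x₁ x₂ x₃ x₄ : A) (a b c : ℂ), IsAdapted β x₁ x₂ x₃ x₄ a b c := by
  have hL3 := leibSpan_eq_lpow_three hleib h4 hA2 hA3 hLeib
  have hsq (y : A) : β y y ∈ lpow β 3 := hL3 ▸ mul_self_mem_leibSpan y
  have hsymm (y w : A) : β y w + β w y ∈ lpow β 3 := hL3 ▸ mul_add_mul_mem_leibSpan y w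
  obtain ⟨x₁, x₂, hx₁, hx₂, hgen⟩ := exists_generators hleib h4 hdim hA2 hA3
  have h₃ : β x₁ x₂ ∈ lpow β 2 := mul_mem_lpow_succ (n := 0) x₁ trivial
  have h₃' : β x₁ x₂ ∉ lpow β 3 := by
    intro h
    have hle : lpow β 2 ≤ lpow β 3 := by
      refine Submodule.span_le.2 ?_
      rintro _ ⟨y, w, -, rfl⟩
      have h₂₁ : β x₂ x₁ ∈ lpow β 3 := ((lpow β 3).add_mem_iff_right h).1 (hsymm x₁ x₂)
      have hmul (t : A) (ht₁ : β t x₁ ∈ lpow β 3) (ht₂ : β t x₂ ∈ lpow β 3) :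
          β t w ∈ lpow β 3 := by
        obtain ⟨p, q, u, hu, rfl⟩ := hgen w
        simp only [map_add, map_smul]
        exact add_mem (add_mem (Submodule.smul_mem _ _ ht₁) (Submodule.smul_mem _ _ ht₂))
          (mul_mem_lpow_succ (n := 1) t hu)
      obtain ⟨p, q, u, hu, rfl⟩ := hgen y
      simp only [map_add, map_smul, LinearMap.add_apply, LinearMap.smul_apply]
      exact add_mem (add_mem (Submodule.smul_mem _ _ (hmul x₁ (hsq x₁) h))
        (Submodule.smul_mem _ _ (hmul x₂ h₂₁ (hsq x₂)))) (mul_mem_lpow_three hleib hu w)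
    have hfd : FiniteDimensional ℂ (lpow β 3) := Module.finite_of_finrank_eq_succ hA3
    have := Submodule.finrank_mono hle
    omega
  have h₄ : β x₁ (β x₁ x₂) ∈ lpow β 3 := mul_mem_lpow_succ (n := 1) x₁ h₃
  have h₄' : β x₁ (β x₁ x₂) ≠ 0 := hx₁ _ h₃ h₃'
  have hspan {w : A} (hw : w ∈ lpow β 3) : ∃ r : ℂ, w = r • β x₁ (β x₁ x₂) := by
    obtain ⟨r, hr⟩ := (finrank_eq_one_iff_of_nonzero' (⟨_, h₄⟩ : lpow β 3)
      (fun h => h₄' (Subtype.ext_iff.1 h))).1 hA3 ⟨w, hw⟩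
    exact ⟨r, (Subtype.ext_iff.1 hr).symm⟩
  obtain ⟨a, ha⟩ := hspan (hsq x₁)
  obtain ⟨b, hb⟩ := hspan (hsymm x₁ x₂)
  obtain ⟨c, hc⟩ := hspan (hsq x₂)
  have hb' : β x₂ x₁ = -β x₁ x₂ + b • β x₁ (β x₁ x₂) := by rw [← hb]; abel
  refine ⟨x₁, x₂, β x₁ x₂, β x₁ (β x₁ x₂), a, b, c, h₄', ha, rfl, hb', hc, rfl, hx₂ _ h₃, ?_, ?_,
    lpow_two_mul_lpow_two hleib h4 h₃ h₃, lpow_three_mul hleib h4 h₄,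
    fun y => mul_lpow_three h4 y h₄⟩
  · have h := hleib x₁ x₂ x₁
    rw [hx₂ _ (mul_mem_lpow_succ (n := 0) x₁ trivial), hb', map_add, map_neg, map_smul,
      mul_lpow_three h4 x₁ h₄, smul_zero, add_zero, add_zero] at h
    exact h.symm
  · have h := hleib x₁ x₂ x₂
    rwa [hc, map_smul, mul_lpow_three h4 x₁ h₄, smul_zero, hx₂ _ h₃, add_zero, eq_comm] at h

end LowerCentralSeries

/-- Classification with `dim A² = 2`, `dim Leib(A) = 1 = dim A³`. -/
theorem four_dim_nilpotent_dimAsq_two_dimAcube_one_leib_one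
    {A : Type*} [AddCommGroup A] [Module ℂ A]
    (β : A →ₗ[ℂ] A →ₗ[ℂ] A) (hleib : IsLeibniz β)
    (hdim : Module.finrank ℂ A = 4)
    (hnonsplit : ¬ LeibIsSplit β)
    (hnonlie : leibSpan β ≠ ⊥)
    (hnilp : LeibNilpotent β)
    (hA2 : Module.finrank ℂ (lpow β 2) = 2)
    (hLeib : Module.finrank ℂ (leibSpan β) = 1)
    (hA3 : Module.finrank ℂ (lpow β 3) = 1) :
    LeibIso β (mkBil sA10) ∨ LeibIso β (mkBil sA11) ∨
      LeibIso β (mkBil sA12) ∨ LeibIso β (mkBil sA13) := by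
  have h4 := lpow_four_eq_bot hnilp hA3
  obtain ⟨x₁, x₂, x₃, x₄, a, b, c, h⟩ := exists_isAdapted hleib h4 hdim hA2 hA3 hLeib
  refine h.classification hdim ?_
  by_contra! hsq
  refine hnonlie (le_bot_iff.1 (Submodule.span_le.2 ?_))
  rintro _ ⟨x, rfl⟩
  exact hsq x
end
end

section
/- Let A be a 4-dimensional non-split non-Lie nilpotent Leibniz algebra over ℂ with dim A² = 2 = dim Leib(A) and dim A³ = 0. Then A is isomorphic to the Leibniz algebra with basis {x1,x2,x3,x4} whose nonzero products are given by one of the following: (A14) [x1,x1]=x3, [x1,x2]=x4; (A15) [x1,x1]=x3, [x2,x1]=x4; (A16) [x1,x2]=x4, [x2,x1]=x3, [x2,x2]=−x3; (A17) [x1,x1]=x3, [x1,x2]=x4, [x2,x1]=α·x4 for some α ∈ ℂ\{−1,0}; (A18) [x1,x1]=x3, [x2,x1]=x4, [x1,x2]=α·x3, [x2,x2]=−x4 for some α ∈ ℂ\{−1}; (A19) [x1,x1]=x3, [x1,x2]=x3, [x2,x1]=x3+x4, [x2,x2]=x4. -/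
noncomputable section

open Module

/-- `x` and `y` span `A` modulo `A²`. -/
def GeneratesModSquare {A : Type*} [AddCommGroup A] [Module ℂ A]
    (β : A →ₗ[ℂ] A →ₗ[ℂ] A) (x y : A) : Prop :=
  ∀ a : A, ∃ c d : ℂ, ∃ z ∈ lpow β 2, a = c • x + d • y + z

section

variable {A : Type*} [AddCommGroup A] [Module ℂ A] {β : A →ₗ[ℂ] A →ₗ[ℂ] A}

theorem bracket_mem_lpow_two (a b : A) : β a b ∈ lpow β 2 :=
  Submodule.subset_span ⟨a, b, Submodule.mem_top, rfl⟩

theorem bracket_lpow_two_right (h : lpow β 3 = ⊥) {z : A} (hz : z ∈ lpow β 2) (a : A) :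
    β a z = 0 := by
  have : β a z ∈ lpow β 3 := Submodule.subset_span ⟨a, z, hz, rfl⟩
  rwa [h, Submodule.mem_bot] at this

theorem lpow_two_subset_centerSet (hleib : IsLeibniz β) (h : lpow β 3 = ⊥) :
    ∀ z ∈ lpow β 2, z ∈ centerSet β := by
  intro z hz a
  refine ⟨?_, bracket_lpow_two_right h hz a⟩
  change z ∈ Submodule.span ℂ _ at hz
  induction hz using Submodule.span_induction with
  | mem z hz =>
    obtain ⟨b, c, -, rfl⟩ := hz
    have := hleib b c a
    rw [bracket_lpow_two_right h (bracket_mem_lpow_two c a),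
      bracket_lpow_two_right h (bracket_mem_lpow_two b a), add_zero] at this
    exact this.symm
  | zero => simp
  | add u v _ _ hu hv => simp [hu, hv]
  | smul c u _ hu => simp [hu]

theorem leibSpan_le_lpow_two : leibSpan β ≤ lpow β 2 :=
  Submodule.span_le.2 fun _ ⟨a, ha⟩ => ha ▸ bracket_mem_lpow_two a a

theorem mkBil_single (f : Fin 4 → Fin 4 → Fin 4 → ℂ) (i j : Fin 4) :
    mkBil f (Pi.single i 1) (Pi.single j 1) = f i j := by
  simp only [mkBil, LinearMap.mk₂_apply]
  rw [Finset.sum_eq_single i (fun k _ hk => by simp [hk]) (by simp),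
    Finset.sum_eq_single j (fun k _ hk => by simp [hk]) (by simp)]
  simp

theorem leibIso_mkBil_of_basis (b : Basis (Fin 4) ℂ A) (f : Fin 4 → Fin 4 → Fin 4 → ℂ)
    (h : ∀ i j, β (b i) (b j) = ∑ k, f i j k • b k) : LeibIso β (mkBil f) := by
  refine ⟨b.equivFun, ?_⟩
  have : β.compr₂ b.equivFun.toLinearMap =
      (mkBil f).compl₁₂ b.equivFun.toLinearMap b.equivFun.toLinearMap := by
    refine b.ext fun i => b.ext fun j => ?_
    have hb : ∀ i, b.equivFun (b i) = Pi.single i 1 := fun i => by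
      ext j
      simp [Basis.equivFun_self, Pi.single_apply, eq_comm]
    simp only [LinearMap.compr₂_apply, LinearMap.compl₁₂_apply, LinearEquiv.coe_coe, hb,
      mkBil_single, h, map_sum, map_smul]
    ext k
    simp [Finset.sum_apply, Pi.single_apply]
  intro x y
  exact LinearMap.congr_fun₂ this x y

namespace GeneratesModSquare

variable {x y : A}

theorem of_combination (hg : GeneratesModSquare β x y) {u v : A} (p q r s : ℂ)
    (hx : x = p • u + q • v) (hy : y = r • u + s • v) : GeneratesModSquare β u v := by
  intro a
  obtain ⟨c, d, z, hz, rfl⟩ := hg a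
  exact ⟨c * p + d * r, c * q + d * s, z, hz, by rw [hx, hy]; module⟩

theorem bracket_eq (hg : GeneratesModSquare β x y) (hc : ∀ z ∈ lpow β 2, z ∈ centerSet β)
    (a b : A) : ∃ c d c' d' : ℂ, ∃ z ∈ lpow β 2, ∃ z' ∈ lpow β 2,
      a = c • x + d • y + z ∧ b = c' • x + d' • y + z' ∧
      β a b = (c * c') • β x x + (c * d') • β x y + (d * c') • β y x + (d * d') • β y y := by
  obtain ⟨c, d, z, hz, rfl⟩ := hg a
  obtain ⟨c', d', z', hz', rfl⟩ := hg b
  refine ⟨c, d, c', d', z, hz, z', hz', rfl, rfl, ?_⟩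
  have h1 := fun a => (hc z hz a).1
  have h2 := fun a => (hc z' hz' a).2
  simp only [map_add, map_smul, LinearMap.add_apply, LinearMap.smul_apply, h1, h2, smul_zero,
    add_zero]
  module

theorem lpow_two_le (hg : GeneratesModSquare β x y) (hc : ∀ z ∈ lpow β 2, z ∈ centerSet β)
    {S : Submodule ℂ A} (hxx : β x x ∈ S) (hxy : β x y ∈ S) (hyx : β y x ∈ S)
    (hyy : β y y ∈ S) : lpow β 2 ≤ S := by
  refine Submodule.span_le.2 ?_
  rintro _ ⟨a, b, -, rfl⟩
  obtain ⟨c, d, c', d', z, -, z', -, -, -, h⟩ := hg.bracket_eq hc a b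
  rw [h]
  exact S.add_mem (S.add_mem (S.add_mem (S.smul_mem _ hxx) (S.smul_mem _ hxy))
    (S.smul_mem _ hyx)) (S.smul_mem _ hyy)

theorem leibSpan_le (hg : GeneratesModSquare β x y) (hc : ∀ z ∈ lpow β 2, z ∈ centerSet β)
    {S : Submodule ℂ A} (hxx : β x x ∈ S) (hs : β x y + β y x ∈ S)
    (hyy : β y y ∈ S) : leibSpan β ≤ S := by
  refine Submodule.span_le.2 ?_
  rintro _ ⟨a, rfl⟩
  obtain ⟨c, d, z, hz, rfl⟩ := hg a
  have h1 := fun a => (hc z hz a).1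
  have h2 := fun a => (hc z hz a).2
  have : β (c • x + d • y + z) (c • x + d • y + z) =
      (c * c) • β x x + (c * d) • (β x y + β y x) + (d * d) • β y y := by
    simp only [map_add, map_smul, LinearMap.add_apply, LinearMap.smul_apply, h1, h2, smul_zero,
      add_zero]
    module
  rw [this]
  exact S.add_mem (S.add_mem (S.smul_mem _ hxx) (S.smul_mem _ hs)) (S.smul_mem _ hyy)

theorem span_eq_top (hg : GeneratesModSquare β x y) {S : Submodule ℂ A}
    (hx : x ∈ S) (hy : y ∈ S) (hS : lpow β 2 ≤ S) : S = ⊤ := by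
  refine eq_top_iff.2 fun a _ => ?_
  obtain ⟨c, d, z, hz, rfl⟩ := hg a
  exact S.add_mem (S.add_mem (S.smul_mem _ hx) (S.smul_mem _ hy)) (hS hz)

/-- An algebra is determined by the products of two elements generating it modulo its square. -/
theorem leibIso_mkBil (hg : GeneratesModSquare β x y) (hdim : finrank ℂ A = 4)
    (hc : ∀ z ∈ lpow β 2, z ∈ centerSet β) (z w : A) (f : Fin 4 → Fin 4 → Fin 4 → ℂ)
    (h : ∀ i j, β (![x, y, z, w] i) (![x, y, z, w] j) = ∑ k, f i j k • ![x, y, z, w] k) :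
    LeibIso β (mkBil f) := by
  set v : Fin 4 → A := ![x, y, z, w] with hv
  have hm : ∀ i, v i ∈ Submodule.span ℂ (Set.range v) := fun i =>
    Submodule.subset_span ⟨i, rfl⟩
  have hb : ∀ i j, β (v i) (v j) ∈ Submodule.span ℂ (Set.range v) := fun i j => by
    rw [h]
    exact Submodule.sum_mem _ fun k _ => Submodule.smul_mem _ _ (hm k)
  have htop : Submodule.span ℂ (Set.range v) = ⊤ :=
    hg.span_eq_top (hm 0) (hm 1) (hg.lpow_two_le hc (hb 0 0) (hb 0 1) (hb 1 0) (hb 1 1))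
  refine leibIso_mkBil_of_basis
    (basisOfTopLeSpanOfCardEqFinrank v htop.ge (by simp [hdim])) f ?_
  simpa using h

theorem leibIsSplit (hg : GeneratesModSquare β x y) (hdim : finrank ℂ A = 4)
    (hc : ∀ z ∈ lpow β 2, z ∈ centerSet β) (hxy : β x y = 0) (hyx : β y x = 0) :
    LeibIsSplit β := by
  let I := Submodule.span ℂ {x, β x x}
  let J := Submodule.span ℂ {y, β y y}
  have hxI : x ∈ I := Submodule.subset_span (by simp)
  have hxxI : β x x ∈ I := Submodule.subset_span (by simp)
  have hyJ : y ∈ J := Submodule.subset_span (by simp)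
  have hyyJ : β y y ∈ J := Submodule.subset_span (by simp)
  have hsup : I ⊔ J = ⊤ := by
    have hI : I ≤ I ⊔ J := le_sup_left
    have hJ : J ≤ I ⊔ J := le_sup_right
    refine hg.span_eq_top (hI hxI) (hJ hyJ) (hg.lpow_two_le hc (hI hxxI) ?_ ?_ (hJ hyyJ))
    · simp [hxy]
    · simp [hyx]
  have : FiniteDimensional ℂ A := FiniteDimensional.of_finrank_eq_succ hdim
  have card_le : ∀ u v : A, finrank ℂ (Submodule.span ℂ {u, v}) ≤ 2 := fun u v => by
    classical
    have h1 := finrank_span_finset_le_card (R := ℂ) ({u, v} : Finset A)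
    rw [Finset.coe_pair] at h1
    exact h1.trans Finset.card_le_two
  have hI2 : finrank ℂ I ≤ 2 := card_le _ _
  have hJ2 : finrank ℂ J ≤ 2 := card_le _ _
  have hadd := Submodule.finrank_sup_add_finrank_inf_eq I J
  rw [hsup, finrank_top, hdim] at hadd
  refine ⟨I, J, ?_, ?_, ?_, ?_, ?_, hsup⟩
  · intro u hu a
    obtain ⟨c, d, rfl⟩ := Submodule.mem_span_pair.1 hu
    obtain ⟨c', d', z, hz, rfl⟩ := hg a
    have h1 := fun a => hc _ (bracket_mem_lpow_two x x) a
    have h2 := fun a => hc z hz a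
    simp [hxy, hyx, fun a => (h1 a).1, fun a => (h1 a).2, fun a => (h2 a).1,
      fun a => (h2 a).2, I.smul_mem, hxxI]
  · intro u hu a
    obtain ⟨c, d, rfl⟩ := Submodule.mem_span_pair.1 hu
    obtain ⟨c', d', z, hz, rfl⟩ := hg a
    have h1 := fun a => hc _ (bracket_mem_lpow_two y y) a
    have h2 := fun a => hc z hz a
    simp [hxy, hyx, fun a => (h1 a).1, fun a => (h1 a).2, fun a => (h2 a).1,
      fun a => (h2 a).2, J.smul_mem, hyyJ]
  · intro h0
    rw [h0, finrank_bot] at hadd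
    lia
  · intro h0
    rw [h0, finrank_bot] at hadd
    lia
  · exact Submodule.finrank_eq_zero.1 (by lia)

theorem exists_of_finrank (hdim : finrank ℂ A = 4) (hA2 : finrank ℂ (lpow β 2) = 2) :
    ∃ x y : A, GeneratesModSquare β x y := by
  have : FiniteDimensional ℂ A := FiniteDimensional.of_finrank_eq_succ hdim
  obtain ⟨C, hC⟩ := Submodule.exists_isCompl (lpow β 2)
  have h2 : finrank ℂ C = 2 := by
    have := Submodule.finrank_add_eq_of_isCompl hC
    lia
  let b := finBasisOfFinrankEq ℂ C h2
  refine ⟨b 0, b 1, fun a => ?_⟩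
  have ha : a ∈ lpow β 2 ⊔ C := hC.sup_eq_top ▸ Submodule.mem_top
  obtain ⟨z, hz, c, hcC, rfl⟩ := Submodule.mem_sup.1 ha
  refine ⟨b.repr ⟨c, hcC⟩ 0, b.repr ⟨c, hcC⟩ 1, z, hz, ?_⟩
  have := congrArg Subtype.val (b.sum_repr ⟨c, hcC⟩)
  simp only [Fin.sum_univ_two, Submodule.coe_add, Submodule.coe_smul] at this
  rw [this, add_comm]

/-- Generators can be chosen so that they anticommute, or so that the second squares to zero. -/
theorem exists_normalized (hg : GeneratesModSquare β x y) (hA2 : finrank ℂ (lpow β 2) = 2) :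
    ∃ u v : A, GeneratesModSquare β u v ∧ (β u v + β v u = 0 ∨ β v v = 0) := by
  have hfin : FiniteDimensional ℂ (lpow β 2) := FiniteDimensional.of_finrank_eq_succ hA2
  obtain ⟨p, q, r, hrel, hne⟩ : ∃ p q r : ℂ,
      p • β x x + q • (β x y + β y x) + r • β y y = 0 ∧ ¬ (p = 0 ∧ q = 0 ∧ r = 0) := by
    let v : Fin 3 → lpow β 2 := ![⟨β x x, bracket_mem_lpow_two x x⟩,
      ⟨β x y + β y x, add_mem (bracket_mem_lpow_two x y) (bracket_mem_lpow_two y x)⟩,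
      ⟨β y y, bracket_mem_lpow_two y y⟩]
    have hv : ¬ LinearIndependent ℂ v := fun hli => by
      have := hli.fintype_card_le_finrank
      simp [hA2] at this
    obtain ⟨g, hg0, i, hi⟩ := Fintype.not_linearIndependent_iff.1 hv
    refine ⟨g 0, g 1, g 2, ?_, fun ⟨h0, h1, h2⟩ => hi ?_⟩
    · simpa [Fin.sum_univ_three, v] using congrArg Subtype.val hg0
    · fin_cases i <;> assumption
  by_cases hp : p = 0
  · by_cases hq : q = 0
    · have hr : r ≠ 0 := fun hr => hne ⟨hp, hq, hr⟩
      exact ⟨x, y, hg, Or.inr (by simpa [hp, hq, hr] using hrel)⟩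
    · refine ⟨y, x + (r / (2 * q)) • y, hg.of_combination (-(r / (2 * q))) 1 1 0 ?_ ?_, Or.inl ?_⟩
      · module
      · module
      · have : β y (x + (r / (2 * q)) • y) + β (x + (r / (2 * q)) • y) y =
            q⁻¹ • (p • β x x + q • (β x y + β y x) + r • β y y) := by
          simp only [hp, map_add, map_smul, LinearMap.add_apply, LinearMap.smul_apply]
          match_scalars <;> field_simp <;> ring
        rw [this, hrel, smul_zero]
  · obtain ⟨δ, hδ⟩ := IsAlgClosed.exists_pow_nat_eq ((q / p) ^ 2 - r / p) two_pos
    by_cases h0 : δ = 0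
    · have hr : r = q ^ 2 / p := by
        rw [h0] at hδ
        field_simp at hδ ⊢
        linear_combination hδ
      refine ⟨y, x + (q / p) • y, hg.of_combination (-(q / p)) 1 1 0 ?_ ?_, Or.inr ?_⟩
      · module
      · module
      · have : β (x + (q / p) • y) (x + (q / p) • y) =
            p⁻¹ • (p • β x x + q • (β x y + β y x) + r • β y y) := by
          simp only [hr, map_add, map_smul, LinearMap.add_apply, LinearMap.smul_apply]
          match_scalars <;> field_simp
        rw [this, hrel, smul_zero]
    · refine ⟨x + (q / p + δ) • y, x + (q / p - δ) • y,
        hg.of_combination (-(q / p - δ) / (2 * δ)) ((q / p + δ) / (2 * δ))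
          (1 / (2 * δ)) (-1 / (2 * δ)) ?_ ?_, Or.inl ?_⟩
      · match_scalars <;> field_simp <;> ring
      · match_scalars <;> field_simp <;> ring
      · have hr : r = p * ((q / p) ^ 2 - δ ^ 2) := by
          rw [hδ]
          field_simp
          ring
        have : β (x + (q / p + δ) • y) (x + (q / p - δ) • y) +
            β (x + (q / p - δ) • y) (x + (q / p + δ) • y) =
            (2 * p⁻¹) • (p • β x x + q • (β x y + β y x) + r • β y y) := by
          simp only [hr, map_add, map_smul, LinearMap.add_apply, LinearMap.smul_apply]
          match_scalars <;> field_simp <;> ring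
        rw [this, hrel, smul_zero]

/-- The case of generators whose second element squares to zero. -/
theorem classification_of_square_eq_zero (hg : GeneratesModSquare β x y)
    (hdim : finrank ℂ A = 4) (hc : ∀ z ∈ lpow β 2, z ∈ centerSet β) (hyy : β y y = 0) {p q : ℂ}
    (hxy : β x y = p • β x x + q • (β x y + β y x)) :
    LeibIso β (mkBil sA14) ∨ LeibIso β (mkBil sA15) ∨ LeibIso β (mkBil sA16) ∨
      ∃ α : ℂ, α ≠ -1 ∧ α ≠ 0 ∧ LeibIso β (mkBil (sA17 α)) := by
  have hB := fun a b c => hc _ (bracket_mem_lpow_two a b) c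
  have hB1 : ∀ a b c, β (β a b) c = 0 := fun a b c => (hB a b c).1
  have hB2 : ∀ a b c, β c (β a b) = 0 := fun a b c => (hB a b c).2
  by_cases hp : p = 0
  · subst hp
    rw [zero_smul, zero_add] at hxy
    by_cases hq : q = 0
    · refine Or.inr (Or.inl (hg.leibIso_mkBil hdim hc (β x x) (β y x) _ ?_))
      rw [hq, zero_smul] at hxy
      intro i j
      fin_cases i <;> fin_cases j <;>
        simp [sA15, E, hB1, hB2, hxy, hyy]
    · have hyx : β y x = ((1 - q) / q) • β x y := by
        have : q • β y x = (1 - q) • β x y := by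
          linear_combination (norm := module) (-1 : ℂ) • hxy
        rw [div_eq_inv_mul, mul_smul, ← this, inv_smul_smul₀ hq]
      by_cases hα : (1 - q) / q = 0
      · rw [hα, zero_smul] at hyx
        refine Or.inl (hg.leibIso_mkBil hdim hc (β x x) (β x y) _ ?_)
        intro i j
        fin_cases i <;> fin_cases j <;>
          simp [sA14, E, hB1, hB2, hyx, hyy]
      · refine Or.inr (Or.inr (Or.inr ⟨(1 - q) / q, ?_, hα,
          hg.leibIso_mkBil hdim hc (β x x) (β x y) _ ?_⟩))
        · intro h
          field_simp at h
          exact one_ne_zero (by linear_combination h : (1 : ℂ) = 0)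
        · intro i j
          fin_cases i <;> fin_cases j <;>
            simp [Fin.sum_univ_four, sA17, E, hB1, hB2, hyx, hyy]
  · refine Or.inr (Or.inr (Or.inl ?_))
    have hg' : GeneratesModSquare β y (-p • x + -q • y) := by
      refine hg.of_combination (-q / p) (-1 / p) 1 0 ?_ ?_
      · match_scalars <;> field_simp
        ring
      · module
    refine hg'.leibIso_mkBil hdim hc (-p • β x y) (-p • β y x) _ ?_
    have hself : (p * p) • β x x + (p * q) • (β x y + β y x) = p • β x y := by
      linear_combination (norm := module) -p • hxy
    intro i j
    fin_cases i <;> fin_cases j <;>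
      simp [sA16, E, hB1, hB2, hyy]
    rw [← hself]
    module

theorem leibIso_sA18 (hg : GeneratesModSquare β x y)
    (hdim : finrank ℂ A = 4) (hc : ∀ z ∈ lpow β 2, z ∈ centerSet β) {a b δ : ℂ}
    (hxy : β x y = a • β x x + b • β y y) (hyx : β y x = -β x y)
    (ha : a ≠ 0) (hδ : δ ^ 2 = 1 + 4 * a * b) (h0 : δ ≠ 0) (h1 : δ ≠ 1) :
    LeibIso β (mkBil (sA18 (4 * a * b))) := by
  have hB := fun a b c => hc _ (bracket_mem_lpow_two a b) c
  have hB1 : ∀ a b c, β (β a b) c = 0 := fun a b c => (hB a b c).1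
  have hB2 : ∀ a b c, β c (β a b) = 0 := fun a b c => (hB a b c).2
  have h1' : 1 - δ ≠ 0 := sub_ne_zero.2 h1.symm
  have hb : b = (δ ^ 2 - 1) / (4 * a) := by
    field_simp
    linear_combination -hδ
  set u := (2 * a) • x + (1 - δ) • y with hu
  set v := (2 * a * (δ - 1)) • x + ((1 - δ) * (-δ - 1)) • y with hv
  have hg' : GeneratesModSquare β u v := by
    refine hg.of_combination ((δ + 1) / (4 * a * δ)) (1 / (4 * a * δ))
      ((δ - 1) / (2 * δ * (1 - δ))) (-1 / (2 * δ * (1 - δ))) ?_ ?_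
    · rw [hu, hv]
      match_scalars <;> field_simp <;> ring
    · rw [hu, hv]
      match_scalars <;> field_simp <;> ring
  have huv : β u v = (4 * a * b) • β u u := by
    simp only [hu, hv, map_add, map_smul, LinearMap.add_apply, LinearMap.smul_apply, hyx, hxy, hb]
    match_scalars <;> field_simp <;> ring
  have hvv : β v v = -β v u := by
    simp only [hu, hv, map_add, map_smul, LinearMap.add_apply, LinearMap.smul_apply, hyx, hxy, hb]
    match_scalars <;> field_simp <;> ring
  refine hg'.leibIso_mkBil hdim hc (β u u) (β v u) _ ?_
  clear_value u v
  intro i j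
  fin_cases i <;> fin_cases j <;>
    simp [Fin.sum_univ_four, sA18, E, hB1, hB2, huv, hvv]

theorem leibIso_sA19 (hg : GeneratesModSquare β x y)
    (hdim : finrank ℂ A = 4) (hc : ∀ z ∈ lpow β 2, z ∈ centerSet β) {a b : ℂ}
    (hxy : β x y = a • β x x + b • β y y) (hyx : β y x = -β x y)
    (hab : 4 * a * b = -1) : LeibIso β (mkBil sA19) := by
  have hB := fun a b c => hc _ (bracket_mem_lpow_two a b) c
  have hB1 : ∀ a b c, β (β a b) c = 0 := fun a b c => (hB a b c).1
  have hB2 : ∀ a b c, β c (β a b) = 0 := fun a b c => (hB a b c).2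
  have ha : a ≠ 0 := by
    rintro rfl
    norm_num at hab
  have hb : b = -1 / (4 * a) := by
    field_simp
    linear_combination hab
  have hI : Complex.I ^ 2 = -1 := Complex.I_sq
  have hI0 : Complex.I ≠ 0 := Complex.I_ne_zero
  generalize Complex.I = ι at hI hI0
  set u := (2 * a) • x + y with hu
  set v := (2 * a * (1 + ι)) • x + (1 - ι) • y with hv
  have hg' : GeneratesModSquare β u v := by
    refine hg.of_combination (-(1 - ι) / (4 * a * ι)) (1 / (4 * a * ι))
      ((1 + ι) / (2 * ι)) (-1 / (2 * ι)) ?_ ?_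
    · rw [hu, hv]
      match_scalars <;> field_simp <;> ring
    · rw [hu, hv]
      match_scalars <;> field_simp <;> ring
  have huv : β u v = β u u := by
    simp only [hu, hv, map_add, map_smul, LinearMap.add_apply, LinearMap.smul_apply, hyx, hxy, hb]
    match_scalars <;> field_simp <;> ring
  have hvu : β v u = β u u + β v v := by
    simp only [hu, hv, map_add, map_smul, LinearMap.add_apply, LinearMap.smul_apply, hyx, hxy, hb]
    match_scalars <;> field_simp <;> grind
  refine hg'.leibIso_mkBil hdim hc (β u u) (β v v) _ ?_
  clear_value u v
  intro i j
  fin_cases i <;> fin_cases j <;>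
    simp [Fin.sum_univ_four, sA19, E, hB1, hB2, huv, hvu]

/-- The case of anticommuting generators. -/
theorem classification_of_anticommute (hg : GeneratesModSquare β x y)
    (hdim : finrank ℂ A = 4) (hc : ∀ z ∈ lpow β 2, z ∈ centerSet β)
    (hsplit : ¬ LeibIsSplit β) {a b : ℂ}
    (hxy : β x y = a • β x x + b • β y y) (hyx : β y x = -β x y) :
    (∃ α : ℂ, α ≠ -1 ∧ LeibIso β (mkBil (sA18 α))) ∨ LeibIso β (mkBil sA19) := by
  by_cases hab : 4 * a * b = -1
  · exact Or.inr (hg.leibIso_sA19 hdim hc hxy hyx hab)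
  refine Or.inl ⟨4 * a * b, hab, ?_⟩
  obtain ⟨δ, hδ, h0, h1⟩ : ∃ δ : ℂ, δ ^ 2 = 1 + 4 * a * b ∧ δ ≠ 0 ∧ δ ≠ 1 := by
    obtain ⟨δ, hδ⟩ := IsAlgClosed.exists_pow_nat_eq (1 + 4 * a * b) two_pos
    have h0 : δ ≠ 0 := by
      rintro rfl
      exact hab (by linear_combination -hδ)
    by_cases h1 : δ = 1
    · exact ⟨-1, by rw [← hδ, h1]; norm_num, by norm_num, by norm_num⟩
    · exact ⟨δ, hδ, h0, h1⟩
  by_cases ha : a = 0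
  · by_cases hb : b = 0
    · have hxy0 : β x y = 0 := by simp [hxy, ha, hb]
      exact absurd (hg.leibIsSplit hdim hc hxy0 (by rw [hyx, hxy0, neg_zero])) hsplit
    · have hg' : GeneratesModSquare β y x := hg.of_combination 0 1 1 0 (by simp) (by simp)
      have := hg'.leibIso_sA18 hdim hc (a := -b) (b := -a) (δ := δ)
        (by rw [hyx, hxy]; module) (by rw [hyx, neg_neg]) (neg_ne_zero.2 hb)
        (by rw [hδ]; ring) h0 h1
      rwa [show 4 * -b * -a = 4 * a * b by ring] at this
  · exact hg.leibIso_sA18 hdim hc hxy hyx ha hδ h0 h1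

end GeneratesModSquare

end

/-- Classification with `dim A² = 2 = dim Leib(A)` and `dim A³ = 0`. -/
theorem four_dim_nilpotent_dimAsq_two_leib_two_dimAcube_zero
    {A : Type*} [AddCommGroup A] [Module ℂ A]
    (β : A →ₗ[ℂ] A →ₗ[ℂ] A) (hleib : IsLeibniz β)
    (hdim : Module.finrank ℂ A = 4)
    (hnonsplit : ¬ LeibIsSplit β)
    (hnonlie : leibSpan β ≠ ⊥)
    (hnilp : LeibNilpotent β)
    (hA2 : Module.finrank ℂ (lpow β 2) = 2)
    (hLeib : Module.finrank ℂ (leibSpan β) = 2)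
    (hA3 : Module.finrank ℂ (lpow β 3) = 0) :
    LeibIso β (mkBil sA14) ∨ LeibIso β (mkBil sA15) ∨ LeibIso β (mkBil sA16) ∨
      (∃ α : ℂ, α ≠ -1 ∧ α ≠ 0 ∧ LeibIso β (mkBil (sA17 α))) ∨
      (∃ α : ℂ, α ≠ -1 ∧ LeibIso β (mkBil (sA18 α))) ∨
      LeibIso β (mkBil sA19) := by
  have : FiniteDimensional ℂ A := FiniteDimensional.of_finrank_eq_succ hdim
  have hc := lpow_two_subset_centerSet hleib (Submodule.finrank_eq_zero.1 hA3)
  have heq : leibSpan β = lpow β 2 :=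
    Submodule.eq_of_le_of_finrank_eq leibSpan_le_lpow_two (hLeib.trans hA2.symm)
  obtain ⟨x₀, y₀, hg₀⟩ := GeneratesModSquare.exists_of_finrank (β := β) hdim hA2
  obtain ⟨x, y, hg, hanti | hyy⟩ := hg₀.exists_normalized hA2
  · have hxy : β x y ∈ Submodule.span ℂ {β x x, β y y} := by
      have hle : leibSpan β ≤ Submodule.span ℂ {β x x, β y y} :=
        hg.leibSpan_le hc (Submodule.subset_span (by simp)) (by simp [hanti])
          (Submodule.subset_span (by simp))
      exact hle (heq ▸ bracket_mem_lpow_two x y)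
    obtain ⟨a, b, hab⟩ := Submodule.mem_span_pair.1 hxy
    exact Or.inr (Or.inr (Or.inr (Or.inr
      (hg.classification_of_anticommute hdim hc hnonsplit hab.symm
        (eq_neg_of_add_eq_zero_right hanti)))))
  · have hxy : β x y ∈ Submodule.span ℂ {β x x, β x y + β y x} := by
      have hle : leibSpan β ≤ Submodule.span ℂ {β x x, β x y + β y x} :=
        hg.leibSpan_le hc (Submodule.subset_span (by simp))
          (Submodule.subset_span (by simp)) (by simp [hyy])
      exact hle (heq ▸ bracket_mem_lpow_two x y)
    obtain ⟨p, q, hpq⟩ := Submodule.mem_span_pair.1 hxy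
    rcases hg.classification_of_square_eq_zero hdim hc hyy hpq.symm with h | h | h | h
    · exact Or.inl h
    · exact Or.inr (Or.inl h)
    · exact Or.inr (Or.inr (Or.inl h))
    · exact Or.inr (Or.inr (Or.inr (Or.inl h)))
end
end
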